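/- Let z₀, z₁ > 0 and I₀, I₁ ∈ ℝ, and let σ be a continuous function on the closed unit square with σ ≥ ε for some ε > 0. Then there exists a constant c > 0 such that for every u continuously differentiable on an open neighborhood of the closed unit square and every (U₀,U₁) ∈ ℝ² with U₀ + U₁ = 0, the energy functional satisfies F_σ(u, U) ≥ (c/2)( ∫_Ω (u² + |∇u|²) dxdy + U₀² + U₁² ) − (1/(2c))(I₀² + I₁²), where Ω = (0,1)×(0,1). -/

import Mathlib

open MeasureTheory Set

/-- Partial derivative in the first (x) variable. -/
noncomputable def pdx (u : ℝ × ℝ → ℝ) (p : ℝ × ℝ) : ℝ :=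
  deriv (fun t => u (t, p.2)) p.1

/-- Partial derivative in the second (y) variable. -/
noncomputable def pdy (u : ℝ × ℝ → ℝ) (p : ℝ × ℝ) : ℝ :=
  deriv (fun t => u (p.1, t)) p.2

/-- Euclidean norm of the gradient `|∇u|`. -/
noncomputable def gradNorm (u : ℝ × ℝ → ℝ) (p : ℝ × ℝ) : ℝ :=
  Real.sqrt ((pdx u p) ^ 2 + (pdy u p) ^ 2)

/-- The closed unit square `[0,1] × [0,1]`. -/
def SQ : Set (ℝ × ℝ) := Icc (0 : ℝ) 1 ×ˢ Icc (0 : ℝ) 1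

/-- The open unit square `(0,1) × (0,1)`. -/
def SQo : Set (ℝ × ℝ) := Ioo (0 : ℝ) 1 ×ˢ Ioo (0 : ℝ) 1

/-- `v` is continuously differentiable on an open neighborhood of the closed unit square. -/
def C1Nbhd (v : ℝ × ℝ → ℝ) : Prop :=
  ∃ W : Set (ℝ × ℝ), IsOpen W ∧ SQ ⊆ W ∧ ContDiffOn ℝ 1 v W

/-- A classical solution `(u, (U₀, U₁))` of the Complete Electrode Model on the unit square
for the conductivity `σ`, constant impedances `z₀, z₁` (bottom/top electrodes) and
input currents `I₀, I₁`. -/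
structure IsCEMSolution (σ u : ℝ × ℝ → ℝ) (U₀ U₁ z₀ z₁ I₀ I₁ : ℝ) : Prop where
  smooth : ∃ W : Set (ℝ × ℝ), IsOpen W ∧ SQ ⊆ W ∧ ContDiffOn ℝ 2 u W
  ground : U₀ + U₁ = 0
  pde : ∀ p ∈ SQo,
    pdx (fun q => σ q * pdx u q) p + pdy (fun q => σ q * pdy u q) p = 0
  robin_bot : ∀ x ∈ Icc (0 : ℝ) 1, u (x, 0) - z₀ * σ (x, 0) * pdy u (x, 0) = U₀
  robin_top : ∀ x ∈ Icc (0 : ℝ) 1, u (x, 1) + z₁ * σ (x, 1) * pdy u (x, 1) = U₁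
  flux_bot : (∫ x in (0 : ℝ)..1, -(σ (x, 0) * pdy u (x, 0))) = I₀
  flux_top : (∫ x in (0 : ℝ)..1, σ (x, 1) * pdy u (x, 1)) = I₁
  noflux_left : ∀ y ∈ Icc (0 : ℝ) 1, pdx u (0, y) = 0
  noflux_right : ∀ y ∈ Icc (0 : ℝ) 1, pdx u (1, y) = 0

/-- The weighted least-gradient functional `G_a` with CEM boundary terms. -/
noncomputable def Gfun (a : ℝ × ℝ → ℝ) (z₀ z₁ I₀ I₁ : ℝ) (v : ℝ × ℝ → ℝ)
    (V₀ V₁ : ℝ) : ℝ :=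
  (∫ p in SQo, a p * gradNorm v p)
    + (1 / (2 * z₀)) * (∫ x in (0 : ℝ)..1, (v (x, 0) - V₀) ^ 2)
    + (1 / (2 * z₁)) * (∫ x in (0 : ℝ)..1, (v (x, 1) - V₁) ^ 2)
    - I₀ * V₀ - I₁ * V₁

/-- The CEM energy functional `F_σ`. -/
noncomputable def Ffun (σ : ℝ × ℝ → ℝ) (z₀ z₁ I₀ I₁ : ℝ) (v : ℝ × ℝ → ℝ)
    (V₀ V₁ : ℝ) : ℝ :=
  (1 / 2) * (∫ p in SQo, σ p * ((pdx v p) ^ 2 + (pdy v p) ^ 2))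
    + (1 / (2 * z₀)) * (∫ x in (0 : ℝ)..1, (v (x, 0) - V₀) ^ 2)
    + (1 / (2 * z₁)) * (∫ x in (0 : ℝ)..1, (v (x, 1) - V₁) ^ 2)
    - I₀ * V₀ - I₁ * V₁

theorem isCompact_SQ : IsCompact SQ := isCompact_Icc.prod isCompact_Icc

theorem SQo_subset_SQ : SQo ⊆ SQ := prod_mono Ioo_subset_Icc_self Ioo_subset_Icc_self

theorem measurableSet_SQo : MeasurableSet SQo := measurableSet_Ioo.prod measurableSet_Ioo

theorem ContinuousOn.integrableOn_SQo {f : ℝ × ℝ → ℝ} (hf : ContinuousOn f SQ) :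
    IntegrableOn f SQo :=
  (hf.integrableOn_compact isCompact_SQ).mono_set SQo_subset_SQ

/-- Fubini on the unit square. -/
theorem integral_SQo_eq {f : ℝ × ℝ → ℝ} (hf : ContinuousOn f SQ) :
    ∫ p in SQo, f p = ∫ x in (0 : ℝ)..1, ∫ y in (0 : ℝ)..1, f (x, y) := by
  have h := hf.integrableOn_SQo
  rw [SQo, Measure.volume_eq_prod] at h ⊢
  rw [setIntegral_prod _ h]
  simp only [intervalIntegral.integral_of_le zero_le_one, integral_Ioc_eq_integral_Ioo]

theorem intervalIntegrable_integral_of_continuousOn {f : ℝ × ℝ → ℝ} (hf : ContinuousOn f SQ) :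
    IntervalIntegrable (fun x => ∫ y in (0 : ℝ)..1, f (x, y)) volume 0 1 := by
  have h := hf.integrableOn_SQo
  rw [SQo, Measure.volume_eq_prod, IntegrableOn, ← Measure.prod_restrict] at h
  rw [intervalIntegrable_iff_integrableOn_Ioo_of_le zero_le_one]
  simpa only [IntegrableOn, intervalIntegral.integral_of_le zero_le_one,
    integral_Ioc_eq_integral_Ioo] using h.integral_prod_left

theorem ContinuousOn.comp_vertical {f : ℝ × ℝ → ℝ} (hf : ContinuousOn f SQ) {x : ℝ}
    (hx : x ∈ Icc (0 : ℝ) 1) : ContinuousOn (fun y => f (x, y)) (Icc 0 1) :=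
  hf.comp (by fun_prop) fun _ hy => ⟨hx, hy⟩

theorem ContinuousOn.comp_horizontal {f : ℝ × ℝ → ℝ} (hf : ContinuousOn f SQ) {y : ℝ}
    (hy : y ∈ Icc (0 : ℝ) 1) : ContinuousOn (fun x => f (x, y)) (Icc 0 1) :=
  hf.comp (by fun_prop) fun _ hx => ⟨hx, hy⟩

theorem hasDerivAt_pdx {u : ℝ × ℝ → ℝ} {p : ℝ × ℝ} (h : DifferentiableAt ℝ u p) :
    HasDerivAt (fun t => u (t, p.2)) (fderiv ℝ u p (1, 0)) p.1 :=
  HasFDerivAt.comp_hasDerivAt (f := fun t => (t, p.2)) p.1 h.hasFDerivAt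
    ((hasDerivAt_id _).prodMk (hasDerivAt_const _ _))

theorem hasDerivAt_pdy {u : ℝ × ℝ → ℝ} {p : ℝ × ℝ} (h : DifferentiableAt ℝ u p) :
    HasDerivAt (fun t => u (p.1, t)) (fderiv ℝ u p (0, 1)) p.2 :=
  HasFDerivAt.comp_hasDerivAt (f := fun t => (p.1, t)) p.2 h.hasFDerivAt
    ((hasDerivAt_const _ _).prodMk (hasDerivAt_id _))

namespace C1Nbhd

variable {u : ℝ × ℝ → ℝ}

theorem differentiableAt (hu : C1Nbhd u) {p : ℝ × ℝ} (hp : p ∈ SQ) : DifferentiableAt ℝ u p := by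
  obtain ⟨W, hW, hS, h⟩ := hu
  exact (h.differentiableOn one_ne_zero).differentiableAt (hW.mem_nhds (hS hp))

theorem continuousOn (hu : C1Nbhd u) : ContinuousOn u SQ :=
  fun _ hp => (hu.differentiableAt hp).continuousAt.continuousWithinAt

theorem continuousOn_fderiv (hu : C1Nbhd u) : ContinuousOn (fderiv ℝ u) SQ := by
  obtain ⟨W, hW, hS, h⟩ := hu
  exact (h.continuousOn_fderiv_of_isOpen hW le_rfl).mono hS

theorem continuousOn_pdx (hu : C1Nbhd u) : ContinuousOn (pdx u) SQ :=
  (hu.continuousOn_fderiv.clm_apply continuousOn_const).congr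
    fun _ hp => (hasDerivAt_pdx (hu.differentiableAt hp)).deriv

theorem continuousOn_pdy (hu : C1Nbhd u) : ContinuousOn (pdy u) SQ :=
  (hu.continuousOn_fderiv.clm_apply continuousOn_const).congr
    fun _ hp => (hasDerivAt_pdy (hu.differentiableAt hp)).deriv

/-- The oscillation of `u` along a vertical segment is controlled by the vertical derivative. -/
theorem sq_sub_le (hu : C1Nbhd u) {x y : ℝ} (hx : x ∈ Icc (0 : ℝ) 1) (hy : y ∈ Icc (0 : ℝ) 1) :
    (u (x, y) - u (x, 0)) ^ 2 ≤ ∫ t in (0 : ℝ)..1, (pdy u (x, t)) ^ 2 := by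
  have hc := hu.continuousOn_pdy.comp_vertical hx
  have hsub : uIcc 0 y ⊆ Icc (0 : ℝ) 1 := by
    rw [uIcc_of_le hy.1]
    exact Icc_subset_Icc_right hy.2
  have hsub' : uIcc y 1 ⊆ Icc (0 : ℝ) 1 := by
    rw [uIcc_of_le hy.2]
    exact Icc_subset_Icc_left hy.1
  have hi : IntervalIntegrable (fun t => pdy u (x, t)) volume 0 y :=
    (hc.mono hsub).intervalIntegrable
  have hi2 : IntervalIntegrable (fun t => (pdy u (x, t)) ^ 2) volume 0 y :=
    ((hc.pow 2).mono hsub).intervalIntegrable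
  have hi2' : IntervalIntegrable (fun t => (pdy u (x, t)) ^ 2) volume y 1 :=
    ((hc.pow 2).mono hsub').intervalIntegrable
  have hftc : ∫ t in (0 : ℝ)..y, pdy u (x, t) = u (x, y) - u (x, 0) :=
    intervalIntegral.integral_eq_sub_of_hasDerivAt (f := fun t => u (x, t))
      (fun t ht => (hasDerivAt_pdy (hu.differentiableAt (p := (x, t))
        ⟨hx, hsub ht⟩)).differentiableAt.hasDerivAt) hi
  set a := u (x, y) - u (x, 0)
  have hnn : 0 ≤ ∫ t in (0 : ℝ)..y, (pdy u (x, t) - a) ^ 2 :=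
    intervalIntegral.integral_nonneg hy.1 fun _ _ => sq_nonneg _
  have hexp : ∫ t in (0 : ℝ)..y, (pdy u (x, t) - a) ^ 2
      = (∫ t in (0 : ℝ)..y, (pdy u (x, t)) ^ 2) - 2 * a * a + y * a ^ 2 := by
    have : ∀ t, (pdy u (x, t) - a) ^ 2 = (pdy u (x, t)) ^ 2 - 2 * a * pdy u (x, t) + a ^ 2 :=
      fun t => by ring
    simp only [this]
    rw [intervalIntegral.integral_add (hi2.sub (hi.const_mul _)) (by simp),
      intervalIntegral.integral_sub hi2 (hi.const_mul _), intervalIntegral.integral_const_mul,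
      hftc, intervalIntegral.integral_const, sub_zero, smul_eq_mul]
  have htail : 0 ≤ ∫ t in y..1, (pdy u (x, t)) ^ 2 :=
    intervalIntegral.integral_nonneg hy.2 fun _ _ => sq_nonneg _
  rw [← intervalIntegral.integral_add_adjacent_intervals hi2 hi2']
  nlinarith [mul_nonneg (sub_nonneg.2 hy.2) (sq_nonneg a)]

/-- Poincaré-type inequality adapted to the electrodes. -/
theorem integral_sq_add_le (hu : C1Nbhd u) {U₀ U₁ : ℝ} (hU : U₀ + U₁ = 0) :
    (∫ p in SQo, (u p) ^ 2) + U₀ ^ 2 + U₁ ^ 2 ≤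
      7 * ((∫ p in SQo, (pdy u p) ^ 2) + (∫ x in (0 : ℝ)..1, (u (x, 0) - U₀) ^ 2)
        + ∫ x in (0 : ℝ)..1, (u (x, 1) - U₁) ^ 2) := by
  have hu2 : ContinuousOn (fun p => (u p) ^ 2) SQ := hu.continuousOn.pow 2
  have hd2 : ContinuousOn (fun p => (pdy u p) ^ 2) SQ := hu.continuousOn_pdy.pow 2
  have hb : ∀ y ∈ Icc (0 : ℝ) 1, ∀ V : ℝ,
      IntervalIntegrable (fun x => (u (x, y) - V) ^ 2) volume 0 1 := fun y hy V =>
    (((hu.continuousOn.comp_horizontal hy).sub continuousOn_const).pow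
      2).intervalIntegrable_of_Icc zero_le_one
  have hb₀ := hb 0 (by simp) U₀
  have hb₁ := hb 1 (by simp) U₁
  have hG := intervalIntegrable_integral_of_continuousOn hd2
  have hL := intervalIntegrable_integral_of_continuousOn hu2
  have key : ∀ x ∈ Icc (0 : ℝ) 1,
      (∫ y in (0 : ℝ)..1, (u (x, y)) ^ 2) + (U₀ ^ 2 + U₁ ^ 2) ≤
        7 * ((∫ y in (0 : ℝ)..1, (pdy u (x, y)) ^ 2) + (u (x, 0) - U₀) ^ 2
          + (u (x, 1) - U₁) ^ 2) := by
    intro x hx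
    have hosc := fun y (hy : y ∈ Icc (0 : ℝ) 1) => hu.sq_sub_le hx hy
    set g := ∫ y in (0 : ℝ)..1, (pdy u (x, y)) ^ 2
    have hU₁ : U₁ = -U₀ := by linarith
    subst hU₁
    have hconst : 4 * U₀ ^ 2 ≤ 3 * (g + (u (x, 0) - U₀) ^ 2 + (u (x, 1) - -U₀) ^ 2) := by
      have h1 := hosc 1 (by simp)
      nlinarith [sq_nonneg ((U₀ - u (x, 0)) - (u (x, 0) - u (x, 1))),
        sq_nonneg ((U₀ - u (x, 0)) - (u (x, 1) + U₀)),
        sq_nonneg ((u (x, 0) - u (x, 1)) - (u (x, 1) + U₀))]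
    have hint : ∫ y in (0 : ℝ)..1, (u (x, y)) ^ 2 ≤
        ∫ _ in (0 : ℝ)..1, 3 * (g + (u (x, 0) - U₀) ^ 2 + U₀ ^ 2) := by
      refine intervalIntegral.integral_mono_on zero_le_one
        ((hu2.comp_vertical hx).intervalIntegrable_of_Icc zero_le_one) (by simp) fun y hy => ?_
      have h1 := hosc y hy
      nlinarith [sq_nonneg ((u (x, y) - u (x, 0)) - (u (x, 0) - U₀)),
        sq_nonneg ((u (x, y) - u (x, 0)) - U₀), sq_nonneg ((u (x, 0) - U₀) - U₀)]
    rw [intervalIntegral.integral_const, sub_zero, one_smul] at hint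
    have hg : 0 ≤ g := (sq_nonneg _).trans (hosc 1 (by simp))
    nlinarith [sq_nonneg (u (x, 0) - U₀), sq_nonneg (u (x, 1) - -U₀)]
  have hmono := intervalIntegral.integral_mono_on zero_le_one (hL.add (by simp))
    (((hG.add hb₀).add hb₁).const_mul 7) key
  rw [intervalIntegral.integral_add hL (by simp), intervalIntegral.integral_const_mul,
    intervalIntegral.integral_add (hG.add hb₀) hb₁, intervalIntegral.integral_add hG hb₀,
    intervalIntegral.integral_const, sub_zero, one_smul] at hmono
  rw [integral_SQo_eq hu2, integral_SQo_eq hd2, add_assoc]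
  exact hmono

end C1Nbhd

/-- Coercivity of the CEM energy functional `F_σ`. -/
theorem cem_energy_coercive (z₀ z₁ I₀ I₁ ε : ℝ) (hz₀ : 0 < z₀) (hz₁ : 0 < z₁)
    (hε : 0 < ε) (σ : ℝ × ℝ → ℝ) (hσc : ContinuousOn σ SQ)
    (hσ : ∀ p ∈ SQ, ε ≤ σ p) :
    ∃ c > 0, ∀ u : ℝ × ℝ → ℝ, C1Nbhd u → ∀ U₀ U₁ : ℝ, U₀ + U₁ = 0 →
      (c / 2) * ((∫ p in SQo, (u p) ^ 2 + ((pdx u p) ^ 2 + (pdy u p) ^ 2))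
          + U₀ ^ 2 + U₁ ^ 2)
        - (1 / (2 * c)) * (I₀ ^ 2 + I₁ ^ 2) ≤ Ffun σ z₀ z₁ I₀ I₁ u U₀ U₁ := by
  obtain ⟨c, hc, hcε, hc₀, hc₁⟩ : ∃ c : ℝ, 0 < c ∧ 16 * c ≤ ε ∧ 16 * c ≤ 1 / z₀ ∧
      16 * c ≤ 1 / z₁ := by
    refine ⟨min ε (min (1 / z₀) (1 / z₁)) / 16, by positivity, ?_, ?_, ?_⟩ <;>
      rw [mul_div_cancel₀ _ (by norm_num)] <;> simp
  refine ⟨c, hc, fun u hu U₀ U₁ hU => ?_⟩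
  have hu2 : ContinuousOn (fun p => (u p) ^ 2) SQ := hu.continuousOn.pow 2
  have hx2 := hu.continuousOn_pdx.pow 2
  have hy2 := hu.continuousOn_pdy.pow 2
  have hpoin := hu.integral_sq_add_le hU
  have hgrad : 16 * c * ∫ p in SQo, ((pdx u p) ^ 2 + (pdy u p) ^ 2) ≤
      ∫ p in SQo, σ p * ((pdx u p) ^ 2 + (pdy u p) ^ 2) := by
    rw [← integral_const_mul]
    refine setIntegral_mono_on ((hx2.add hy2).integrableOn_SQo.const_mul _)
      (hσc.mul (hx2.add hy2)).integrableOn_SQo measurableSet_SQo fun p hp => ?_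
    exact mul_le_mul_of_nonneg_right (hcε.trans (hσ p (SQo_subset_SQ hp))) (by positivity)
  have hdy : ∫ p in SQo, (pdy u p) ^ 2 ≤ ∫ p in SQo, ((pdx u p) ^ 2 + (pdy u p) ^ 2) :=
    setIntegral_mono_on hy2.integrableOn_SQo (hx2.add hy2).integrableOn_SQo measurableSet_SQo
      fun p _ => le_add_of_nonneg_left (sq_nonneg _)
  have hsplit : ∫ p in SQo, ((u p) ^ 2 + ((pdx u p) ^ 2 + (pdy u p) ^ 2)) =
      (∫ p in SQo, (u p) ^ 2) + ∫ p in SQo, ((pdx u p) ^ 2 + (pdy u p) ^ 2) :=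
    integral_add hu2.integrableOn_SQo (hx2.add hy2).integrableOn_SQo
  have hL : 0 ≤ ∫ p in SQo, (u p) ^ 2 := integral_nonneg fun _ => sq_nonneg _
  have hA : 0 ≤ ∫ p in SQo, ((pdx u p) ^ 2 + (pdy u p) ^ 2) :=
    integral_nonneg fun _ => add_nonneg (sq_nonneg _) (sq_nonneg _)
  have hB₀ : 0 ≤ ∫ x in (0 : ℝ)..1, (u (x, 0) - U₀) ^ 2 :=
    intervalIntegral.integral_nonneg zero_le_one fun _ _ => sq_nonneg _
  have hB₁ : 0 ≤ ∫ x in (0 : ℝ)..1, (u (x, 1) - U₁) ^ 2 :=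
    intervalIntegral.integral_nonneg zero_le_one fun _ _ => sq_nonneg _
  have young : ∀ a b : ℝ, a * b ≤ c / 2 * b ^ 2 + 1 / (2 * c) * a ^ 2 := fun a b => by
    have h : c / 2 * b ^ 2 + 1 / (2 * c) * a ^ 2 - a * b = (a - c * b) ^ 2 / (2 * c) := by
      field_simp
      ring
    have : 0 ≤ (a - c * b) ^ 2 / (2 * c) := by positivity
    linarith
  have hy₀ := young I₀ U₀
  have hy₁ := young I₁ U₁
  have hweight : ∀ z : ℝ, 16 * c ≤ 1 / z → 8 * c ≤ 1 / (2 * z) := fun z h => by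
    have : 1 / (2 * z) = 1 / z / 2 := by ring
    linarith
  have hm₀ := mul_le_mul_of_nonneg_right (hweight z₀ hc₀) hB₀
  have hm₁ := mul_le_mul_of_nonneg_right (hweight z₁ hc₁) hB₁
  have hmp := mul_le_mul_of_nonneg_left hpoin hc.le
  have hmdy := mul_le_mul_of_nonneg_left hdy hc.le
  have hcL := mul_nonneg hc.le hL
  have hcA := mul_nonneg hc.le hA
  have hcB₀ := mul_nonneg hc.le hB₀
  have hcB₁ := mul_nonneg hc.le hB₁
  rw [hsplit, Ffun]
  linarith
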